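/- arXiv:2010.12830 — 3 statements merged into one kernel-verified Lean document; each statement's English description precedes it below -/
import Mathlib

section
/- Let G be a group with a measurable right action on a probability space (X, 𝒜, ν), let μ be a probability measure on G, let B = G^ℕ carry the infinite product measure β = μ^⊗ℕ, and let T : X × B → X × B be the skew-product map T(x, b) = (x·b₀, shift(b)), where shift(b)ₙ = b_{n+1}. Assume that T is measure-preserving and ergodic with respect to ν ⊗ β. Let σ : X × G → ℝ^d be a measurable ℝ^d-valued cocycle that is integrable with respect to ν ⊗ μ. Then for ν ⊗ β-almost every (x, b) ∈ X × B, the sequence (1/n)·σ(x, b₀b₁⋯b_{n−1}) converges, as n → ∞, to ∫_{X×G} σ(y, g) dν(y) dμ(g). -/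
open MeasureTheory Filter Topology

/-- The maximum of the Birkhoff sums `birkhoffSum T f k x` over `k ≤ n`. -/
noncomputable def birkhoffMax {Ω : Type*} (T : Ω → Ω) (f : Ω → ℝ) : ℕ → Ω → ℝ
  | 0 => fun _ => 0
  | n + 1 => fun x => max 0 (f x + birkhoffMax T f n (T x))

section BirkhoffMax

variable {Ω : Type*} {T : Ω → Ω} {f : Ω → ℝ}

lemma birkhoffMax_nonneg (n : ℕ) (x : Ω) : 0 ≤ birkhoffMax T f n x := by
  cases n with
  | zero => exact le_rfl
  | succ n => exact le_max_left _ _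

lemma birkhoffMax_le_succ (n : ℕ) (x : Ω) :
    birkhoffMax T f n x ≤ birkhoffMax T f (n + 1) x := by
  induction n generalizing x with
  | zero => exact birkhoffMax_nonneg 1 x
  | succ n ih => exact max_le_max le_rfl (add_le_add le_rfl (ih (T x)))

lemma monotone_birkhoffMax (x : Ω) : Monotone fun n => birkhoffMax T f n x :=
  monotone_nat_of_le_succ fun n => birkhoffMax_le_succ n x

lemma birkhoffSum_le_birkhoffMax (n : ℕ) (x : Ω) :
    birkhoffSum T f n x ≤ birkhoffMax T f n x := by
  induction n generalizing x with
  | zero => simp [birkhoffMax]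
  | succ n ih =>
    rw [birkhoffSum_succ']
    exact (add_le_add le_rfl (ih (T x))).trans (le_max_right _ _)

lemma bddAbove_birkhoffMax_comp_iff (x : Ω) :
    BddAbove (Set.range fun n => birkhoffMax T f n (T x)) ↔
      BddAbove (Set.range fun n => birkhoffMax T f n x) := by
  constructor
  · rintro ⟨C, hC⟩
    refine ⟨max 0 (f x + C), ?_⟩
    rintro _ ⟨n, rfl⟩
    exact (birkhoffMax_le_succ n x).trans
      (max_le_max le_rfl (add_le_add le_rfl (hC ⟨n, rfl⟩)))
  · rintro ⟨C, hC⟩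
    refine ⟨C - f x, ?_⟩
    rintro _ ⟨n, rfl⟩
    have h : f x + birkhoffMax T f n (T x) ≤ C :=
      (le_max_right _ _).trans (hC ⟨n + 1, rfl⟩)
    linarith

variable [MeasurableSpace Ω] {m : Measure Ω}

lemma measurable_birkhoffMax (hT : Measurable T) (hf : Measurable f) (n : ℕ) :
    Measurable (birkhoffMax T f n) := by
  induction n with
  | zero => exact measurable_const
  | succ n ih => exact measurable_const.max (hf.add (ih.comp hT))

lemma integrable_birkhoffMax (hT : MeasurePreserving T m m) (hf : Integrable f m) (n : ℕ) :
    Integrable (birkhoffMax T f n) m := by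
  induction n with
  | zero => exact integrable_zero _ _ _
  | succ n ih =>
    exact (integrable_zero _ _ _).sup (hf.add (hT.integrable_comp_of_integrable ih))

/-- The maximal ergodic inequality: if the Birkhoff sums are almost everywhere unbounded above,
then the integral is nonnegative. -/
lemma integral_nonneg_of_ae_not_bddAbove_birkhoffMax (hT : MeasurePreserving T m m)
    (hfm : Measurable f) (hf : Integrable f m)
    (h : ∀ᵐ x ∂m, ¬ BddAbove (Set.range fun n => birkhoffMax T f n x)) :
    0 ≤ ∫ x, f x ∂m := by
  have hlim : Tendsto (fun n => ∫ x, max (-birkhoffMax T f n (T x)) (f x) ∂m) atTop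
      (𝓝 (∫ x, f x ∂m)) := by
    refine tendsto_integral_of_dominated_convergence (fun x => |f x|) (fun n => ?_) hf.abs
      (fun n => ?_) ?_
    · exact (((measurable_birkhoffMax hT.measurable hfm n).comp hT.measurable).neg.max
        hfm).aestronglyMeasurable
    · refine Eventually.of_forall fun x => ?_
      have h0 := birkhoffMax_nonneg (T := T) (f := f) n (T x)
      rw [Real.norm_eq_abs]
      refine abs_le.2 ⟨(neg_abs_le (f x)).trans (le_max_right _ _), max_le ?_ (le_abs_self _)⟩
      exact (neg_nonpos.2 h0).trans (abs_nonneg _)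
    · filter_upwards [h] with x hx
      rw [← bddAbove_birkhoffMax_comp_iff] at hx
      have htop := tendsto_atTop_atTop_of_monotone' (monotone_birkhoffMax (T x)) hx
      refine tendsto_const_nhds.congr' ?_
      filter_upwards [htop.eventually_ge_atTop (-f x)] with n hn
      exact (max_eq_right (by linarith)).symm
  refine ge_of_tendsto' hlim fun n => ?_
  have hcomp : Integrable (fun x => birkhoffMax T f n (T x)) m :=
    hT.integrable_comp_of_integrable (integrable_birkhoffMax hT hf n)
  have heq : ∀ x, max (-birkhoffMax T f n (T x)) (f x) =
      birkhoffMax T f (n + 1) x - birkhoffMax T f n (T x) := fun x => by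
    simp only [birkhoffMax]
    rw [← max_sub_sub_right, zero_sub, add_sub_cancel_right]
  have hint : ∫ x, birkhoffMax T f n (T x) ∂m = ∫ x, birkhoffMax T f n x ∂m := by
    conv_rhs => rw [← hT.map_eq]
    exact (integral_map hT.measurable.aemeasurable
      (measurable_birkhoffMax hT.measurable hfm n).aestronglyMeasurable).symm
  simp_rw [heq]
  rw [integral_sub (integrable_birkhoffMax hT hf (n + 1)) hcomp, hint, sub_nonneg]
  exact integral_mono (integrable_birkhoffMax hT hf n) (integrable_birkhoffMax hT hf (n + 1))
    (birkhoffMax_le_succ n)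

end BirkhoffMax

section Birkhoff

variable {Ω : Type*} [MeasurableSpace Ω] {m : Measure Ω} {T : Ω → Ω} {f : Ω → ℝ}

lemma Ergodic.ae_bddAbove_birkhoffMax (hT : Ergodic T m) (hfm : Measurable f)
    (hf : Integrable f m) (hneg : ∫ x, f x ∂m < 0) :
    ∀ᵐ x ∂m, BddAbove (Set.range fun n => birkhoffMax T f n x) := by
  have hms : MeasurableSet {x | BddAbove (Set.range fun n => birkhoffMax T f n x)} :=
    measurableSet_bddAbove_range fun n => measurable_birkhoffMax hT.measurable hfm n
  rcases hT.ae_mem_or_ae_notMem hms (Set.ext bddAbove_birkhoffMax_comp_iff) with h | h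
  · exact h
  · exact absurd (integral_nonneg_of_ae_not_bddAbove_birkhoffMax hT.toMeasurePreserving hfm hf h)
      hneg.not_ge

lemma Ergodic.ae_eventually_birkhoffAverage_lt [IsProbabilityMeasure m] (hT : Ergodic T m)
    (hfm : Measurable f) (hf : Integrable f m) {c : ℝ} (hc : ∫ x, f x ∂m < c) :
    ∀ᵐ x ∂m, ∀ᶠ n in atTop, birkhoffAverage ℝ T f n x < c := by
  obtain ⟨c', hc', hcc'⟩ := exists_between hc
  have hneg : ∫ x, (f x - c') ∂m < 0 := by
    rw [integral_sub hf (integrable_const _)]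
    simpa using hc'
  filter_upwards [hT.ae_bddAbove_birkhoffMax (hfm.sub_const c') (hf.sub (integrable_const c'))
    hneg] with x ⟨C, hC⟩
  have hlim : Tendsto (fun n : ℕ => c' + C / n) atTop (𝓝 c') := by
    simpa using (tendsto_const_div_atTop_nhds_zero_nat C).const_add c'
  filter_upwards [hlim.eventually_lt_const hcc', eventually_gt_atTop 0] with n hn hn0
  refine lt_of_le_of_lt ?_ hn
  have hn' : (0 : ℝ) < n := by exact_mod_cast hn0
  have hle := (birkhoffSum_le_birkhoffMax n x).trans (hC ⟨n, rfl⟩)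
  have hsum : birkhoffSum T (fun x => f x - c') n x = birkhoffSum T f n x - n * c' := by
    simp [birkhoffSum, Finset.sum_sub_distrib]
  rw [hsum] at hle
  rw [birkhoffAverage, smul_eq_mul, inv_mul_eq_div, div_le_iff₀ hn', add_mul,
    div_mul_cancel₀ _ hn'.ne']
  linarith

/-- **Birkhoff's pointwise ergodic theorem** for an ergodic map and a real observable. -/
theorem Ergodic.ae_tendsto_birkhoffAverage [IsProbabilityMeasure m] (hT : Ergodic T m)
    (hfm : Measurable f) (hf : Integrable f m) :
    ∀ᵐ x ∂m, Tendsto (fun n => birkhoffAverage ℝ T f n x) atTop (𝓝 (∫ x, f x ∂m)) := by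
  obtain ⟨u, -, hu, hulim⟩ := exists_seq_strictAnti_tendsto (0 : ℝ)
  have hupper : ∀ᵐ x ∂m, ∀ k, ∀ᶠ n in atTop,
      birkhoffAverage ℝ T f n x < ∫ x, f x ∂m + u k :=
    ae_all_iff.2 fun k => hT.ae_eventually_birkhoffAverage_lt hfm hf
      (lt_add_of_pos_right _ (hu k))
  have hlower : ∀ᵐ x ∂m, ∀ k, ∀ᶠ n in atTop,
      birkhoffAverage ℝ T (-f) n x < -∫ x, f x ∂m + u k := by
    refine ae_all_iff.2 fun k => hT.ae_eventually_birkhoffAverage_lt hfm.neg hf.neg ?_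
    simpa [integral_neg] using hu k
  filter_upwards [hupper, hlower] with x h₁ h₂
  refine tendsto_order.2 ⟨fun c hc => ?_, fun c hc => ?_⟩
  · obtain ⟨k, hk⟩ := (hulim.eventually_lt_const (sub_pos.2 hc)).exists
    filter_upwards [h₂ k] with n hn
    rw [birkhoffAverage_neg, Pi.neg_apply, Pi.neg_apply] at hn
    linarith
  · obtain ⟨k, hk⟩ := (hulim.eventually_lt_const (sub_pos.2 hc)).exists
    filter_upwards [h₁ k] with n hn
    linarith

/-- Birkhoff's pointwise ergodic theorem for an ergodic map and a vector-valued observable. -/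
theorem Ergodic.ae_tendsto_birkhoffAverage_euclideanSpace [IsProbabilityMeasure m]
    {ι : Type*} [Fintype ι] {g : Ω → EuclideanSpace ℝ ι} (hT : Ergodic T m)
    (hgm : Measurable g) (hg : Integrable g m) :
    ∀ᵐ x ∂m, Tendsto (fun n => birkhoffAverage ℝ T g n x) atTop (𝓝 (∫ x, g x ∂m)) := by
  have hcoord : ∀ᵐ x ∂m, ∀ i, Tendsto (fun n => birkhoffAverage ℝ T (fun y => g y i) n x) atTop
      (𝓝 (∫ x, g x i ∂m)) :=
    ae_all_iff.2 fun i => hT.ae_tendsto_birkhoffAverage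
      ((EuclideanSpace.proj (𝕜 := ℝ) i).continuous.measurable.comp hgm)
      ((EuclideanSpace.proj (𝕜 := ℝ) i).integrable_comp hg)
  filter_upwards [hcoord] with x hx
  rw [(EuclideanSpace.equiv ι ℝ).toHomeomorph.isInducing.tendsto_nhds_iff]
  refine tendsto_pi_nhds.2 fun i => ?_
  have hi := hx i
  have hintegral : ∫ x, g x i ∂m = (∫ x, g x ∂m) i :=
    (EuclideanSpace.proj (𝕜 := ℝ) i).integral_comp_comm hg
  rw [hintegral] at hi
  refine hi.congr fun n => ?_
  exact (map_birkhoffAverage ℝ ℝ (EuclideanSpace.proj (𝕜 := ℝ) i) T g n x).symm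

end Birkhoff

/-- A cocycle along a random product is a Birkhoff sum over the skew product. -/
lemma cocycle_prod_eq_birkhoffSum {X G E : Type*} [Group G] [AddCommGroup E]
    {a : X → G → X} {σ : X → G → E}
    (hone : ∀ x, a x 1 = x)
    (hcoc : ∀ x (g h : G), σ x (g * h) = σ x g + σ (a x g) h) (n : ℕ) (p : X × (ℕ → G)) :
    σ p.1 (((List.range n).map p.2).prod) =
      birkhoffSum (fun p : X × (ℕ → G) => (a p.1 (p.2 0), fun n => p.2 (n + 1)))
        (fun p => σ p.1 (p.2 0)) n p := by
  induction n generalizing p with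
  | zero =>
    have h := hcoc p.1 1 1
    rw [mul_one, hone] at h
    simpa using h
  | succ n ih =>
    rw [birkhoffSum_succ', ← ih, List.range_succ_eq_map, List.map_cons, List.prod_cons, hcoc,
      List.map_map]
    rfl

/-- Let a group `G` act measurably on the right on a probability space
`(X, ν)`, let `μ` be a probability measure on `G` and `β` the infinite product measure
`μ^⊗ℕ` on `B = G^ℕ` (characterized by its values on cylinder sets). If the skew-product
map `T(x, b) = (x·b₀, shift b)` is measure-preserving and ergodic for `ν ⊗ β`, and
`σ : X × G → ℝ^d` is a `ν ⊗ μ`-integrable cocycle, then for `ν ⊗ β`-almost every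
`(x, b)`, `(1/n) σ(x, b₀b₁⋯b_{n-1}) → ∫ σ d(ν ⊗ μ)`. -/
theorem drift_tendsto_expectation_of_ergodic
    {X G : Type*} [MeasurableSpace X] [MeasurableSpace G] [Group G]
    (ν : Measure X) [IsProbabilityMeasure ν]
    (μ : Measure G) [IsProbabilityMeasure μ]
    (a : X → G → X)
    (hone : ∀ x, a x 1 = x)
    (hmul : ∀ x (g h : G), a (a x g) h = a x (g * h))
    (hactmeas : Measurable fun p : X × G => a p.1 p.2)
    (β : Measure (ℕ → G)) [IsProbabilityMeasure β]
    (hβ : ∀ (s : Finset ℕ) (A : ℕ → Set G), (∀ i ∈ s, MeasurableSet (A i)) →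
      β {b | ∀ i ∈ s, b i ∈ A i} = ∏ i ∈ s, μ (A i))
    {d : ℕ} (σ : X → G → EuclideanSpace ℝ (Fin d))
    (hmeas : Measurable fun p : X × G => σ p.1 p.2)
    (hcoc : ∀ x (g h : G), σ x (g * h) = σ x g + σ (a x g) h)
    (hint : Integrable (fun p : X × G => σ p.1 p.2) (ν.prod μ))
    (T : X × (ℕ → G) → X × (ℕ → G))
    (hT : T = fun p => (a p.1 (p.2 0), fun n => p.2 (n + 1)))
    (hErg : Ergodic T (ν.prod β)) :
    ∀ᵐ p ∂(ν.prod β),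
      Tendsto (fun n : ℕ => (n : ℝ)⁻¹ • σ p.1 (((List.range n).map p.2).prod))
        atTop (𝓝 (∫ q, σ q.1 q.2 ∂(ν.prod μ))) := by
  have hmap : β.map (fun b => b 0) = μ := by
    ext A hA
    rw [Measure.map_apply (measurable_pi_apply 0) hA]
    simpa [Set.preimage] using hβ {0} (fun _ => A) fun _ _ => hA
  have hpres : MeasurePreserving (Prod.map id fun b : ℕ → G => b 0) (ν.prod β) (ν.prod μ) :=
    (MeasurePreserving.id ν).prod ⟨measurable_pi_apply 0, hmap⟩
  have hintegral : ∫ p, σ p.1 (p.2 0) ∂(ν.prod β) = ∫ q, σ q.1 q.2 ∂(ν.prod μ) := by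
    rw [← hpres.map_eq]
    exact (integral_map hpres.measurable.aemeasurable hmeas.aestronglyMeasurable).symm
  have hbirkhoff := hErg.ae_tendsto_birkhoffAverage_euclideanSpace
    (hmeas.comp hpres.measurable) (hpres.integrable_comp_of_integrable hint)
  filter_upwards [hbirkhoff] with p hp
  rw [← hintegral]
  refine hp.congr fun n => ?_
  rw [cocycle_prod_eq_birkhoffSum hone hcoc, birkhoffAverage, hT]
  rfl
end

section
/- Let (Z, 𝒵, ℙ) be a probability space and T : Z → Z a measure-preserving ergodic transformation. Let f : Z → ℝ^d be measurable and set Sₙ(z) = Σ_{k=0}^{n−1} f(Tᵏ z). Fix t ∈ ℝ^d and ε > 0, and assume that limsup_{n→∞} ℙ{ z ∈ Z : ‖Sₙ(z)/n − t‖ ≤ ε } > 0. Then for ℙ-almost every z ∈ Z, liminf_{n→∞} ‖Sₙ(z)/n − t‖ ≤ ε. -/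
open MeasureTheory Filter Topology

/-- **Reverse Fatou lemma** for sets, in a finite measure space. -/
theorem limsup_measure_le_measure_limsup {α : Type*} [MeasurableSpace α] (μ : Measure α)
    [IsFiniteMeasure μ] {s : ℕ → Set α} (hs : ∀ n, MeasurableSet (s n)) :
    limsup (fun n => μ (s n)) atTop ≤ μ (limsup s atTop) := by
  have hanti : Antitone fun n => ⨆ i ≥ n, s i :=
    fun _ _ hmn => biSup_mono fun _ hi => le_trans hmn hi
  have hmeas : ∀ n, MeasurableSet (⨆ i ≥ n, s i) :=
    fun n => MeasurableSet.iUnion fun i => MeasurableSet.iUnion fun _ => hs i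
  rw [limsup_eq_iInf_iSup_of_nat, limsup_eq_iInf_iSup_of_nat, Set.iInf_eq_iInter,
    hanti.measure_iInter (fun n => (hmeas n).nullMeasurableSet) ⟨0, measure_ne_top μ _⟩]
  exact iInf_mono fun n => iSup₂_le fun i hi => measure_mono (le_iSup₂_of_le i hi le_rfl)

/-- Shifting the starting point of an orbit backwards by one step does not increase the lower
limit of the distance from its Birkhoff averages to a point. -/
theorem liminf_nnnorm_birkhoffAverage_sub_le {α E : Type*} [NormedAddCommGroup E]
    [NormedSpace ℝ E] (T : α → α) (f : α → E) (t : E) (z : α) :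
    liminf (fun n => (‖birkhoffAverage ℝ T f n z - t‖₊ : ENNReal)) atTop ≤
      liminf (fun n => (‖birkhoffAverage ℝ T f n (T z) - t‖₊ : ENNReal)) atTop := by
  have hzero : Tendsto (fun n : ℕ => (‖((n : ℝ) + 1)⁻¹ • (f z - t)‖₊ : ENNReal)) atTop (𝓝 0) := by
    have h := (tendsto_one_div_add_atTop_nhds_zero_nat (𝕜 := ℝ)).smul_const (f z - t)
    simpa [one_div] using ENNReal.tendsto_coe.2 h.nnnorm
  rw [← liminf_nat_add _ 1,
    ← ENNReal.liminf_add_of_right_tendsto_zero hzero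
      (fun n => (‖birkhoffAverage ℝ T f n (T z) - t‖₊ : ENNReal))]
  refine liminf_le_liminf (Eventually.of_forall fun n => ?_)
  have hn : (n : ℝ) + 1 ≠ 0 := by positivity
  have hdecomp : birkhoffAverage ℝ T f (n + 1) z - t =
      ((n : ℝ) / (n + 1)) • (birkhoffAverage ℝ T f n (T z) - t) +
        ((n : ℝ) + 1)⁻¹ • (f z - t) := by
    rcases eq_or_ne n 0 with rfl | h0
    · simp
    · have h0' : (n : ℝ) ≠ 0 := Nat.cast_ne_zero.2 h0
      simp only [birkhoffAverage, birkhoffSum_succ', Nat.cast_add, Nat.cast_one]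
      match_scalars <;> field_simp
      ring
  have hcoef : ‖(n : ℝ) / (n + 1)‖₊ ≤ 1 := by
    rw [← NNReal.coe_le_coe, coe_nnnorm, Real.norm_of_nonneg (by positivity), NNReal.coe_one]
    exact (div_le_one (by positivity)).2 (by linarith)
  rw [hdecomp, Pi.add_apply, ← ENNReal.coe_add, ENNReal.coe_le_coe]
  refine (nnnorm_add_le _ _).trans (add_le_add_left ?_ _)
  rw [nnnorm_smul]
  exact mul_le_of_le_one_left' hcoef

/-- If `T` is a measure-preserving ergodic transformation of a probability
space `(Z, ℙ)`, `f : Z → ℝ^d` is measurable, `Sₙ = Σ_{k<n} f ∘ Tᵏ`, and for some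
`t ∈ ℝ^d`, `ε > 0` the measures `ℙ{‖Sₙ/n − t‖ ≤ ε}` have positive limsup, then
almost surely `liminfₙ ‖Sₙ(z)/n − t‖ ≤ ε`. -/
theorem liminf_dist_le_of_limsup_measure_pos
    {Z : Type*} [MeasurableSpace Z] (P : Measure Z) [IsProbabilityMeasure P]
    (T : Z → Z) (hT : Ergodic T P)
    {d : ℕ} (f : Z → EuclideanSpace ℝ (Fin d)) (hf : Measurable f)
    (t : EuclideanSpace ℝ (Fin d)) (ε : ℝ) (hε : 0 < ε)
    (hpos : 0 < Filter.limsup (fun n : ℕ =>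
        P {z | ‖(n : ℝ)⁻¹ • (∑ k ∈ Finset.range n, f (T^[k] z)) - t‖ ≤ ε}) atTop) :
    ∀ᵐ z ∂P, Filter.liminf (fun n : ℕ =>
        (‖(n : ℝ)⁻¹ • (∑ k ∈ Finset.range n, f (T^[k] z)) - t‖₊ : ENNReal)) atTop
      ≤ ENNReal.ofReal ε := by
  have hmeas : ∀ n : ℕ, Measurable fun z =>
      (n : ℝ)⁻¹ • (∑ k ∈ Finset.range n, f (T^[k] z)) - t := fun n => by
    have hsum : Measurable fun z => ∑ k ∈ Finset.range n, f (T^[k] z) :=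
      Finset.measurable_fun_sum _ fun k _ => hf.comp (hT.measurable.iterate k)
    exact (hsum.const_smul (n : ℝ)⁻¹).sub_const t
  set E : Set Z := {z | liminf (fun n : ℕ =>
    (‖(n : ℝ)⁻¹ • (∑ k ∈ Finset.range n, f (T^[k] z)) - t‖₊ : ENNReal)) atTop
      ≤ ENNReal.ofReal ε} with hE
  have hEmeas : MeasurableSet E :=
    measurableSet_le (Measurable.liminf fun n => (hmeas n).nnnorm.coe_nnreal_ennreal)
      measurable_const
  have hEinv : T ⁻¹' E ⊆ E := fun z hz =>
    (liminf_nnnorm_birkhoffAverage_sub_le T f t z).trans hz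
  have hEpos : 0 < P E := by
    refine (hpos.trans_le (limsup_measure_le_measure_limsup P fun n =>
      measurableSet_le (hmeas n).norm measurable_const)).trans_le (measure_mono fun z hz => ?_)
    rw [hE, Set.mem_ofPred_eq]
    refine liminf_le_of_frequently_le' ((mem_limsup_iff_frequently_mem.1 hz).mono fun n hn => ?_)
    rw [← enorm_eq_nnnorm, ← ofReal_norm]
    exact ENNReal.ofReal_le_ofReal hn
  rcases hT.ae_empty_or_univ_of_preimage_ae_le hEmeas.nullMeasurableSet hEinv.eventuallyLE
    with h | h
  · exact absurd (ae_eq_empty.1 h) hEpos.ne'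
  · exact eventuallyEq_univ.1 h
end

section
/- Let (Z, 𝒵, ℙ) be a probability space and T : Z → Z a measure-preserving ergodic transformation. Let f : Z → ℝ^d be measurable and set Sₙ(z) = Σ_{k=0}^{n−1} f(Tᵏ z). Assume that the pushforward measures of ℙ under the maps z ↦ Sₙ(z)/n converge weakly (i.e. against all bounded continuous functions ℝ^d → ℝ) to a probability measure m on ℝ^d. Then for ℙ-almost every z ∈ Z, every point of the topological support of m is an accumulation point of the sequence (Sₙ(z)/n)_{n≥1}. -/
open MeasureTheory Filter Topology

/-- If the measures of a sequence of measurable sets are eventually bounded below by `c`, then so is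
the measure of the limit superior of the sequence. -/
lemma le_measure_limsup_of_eventually_le {Z : Type*} [MeasurableSpace Z] {P : Measure Z}
    [IsFiniteMeasure P] {s : ℕ → Set Z} (hs : ∀ n, MeasurableSet (s n)) {c : ENNReal}
    (hc : ∀ᶠ n in atTop, c ≤ P (s n)) : c ≤ P (limsup s atTop) := by
  rw [limsup_eq_iInf_iSup_of_nat]
  simp only [Set.iInf_eq_iInter, Set.iSup_eq_iUnion]
  rw [Antitone.measure_iInter]
  · refine le_iInf fun N => ?_
    obtain ⟨n, hn, hN⟩ := (hc.and (eventually_ge_atTop N)).exists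
    exact hn.trans (measure_mono (Set.subset_biUnion_of_mem (u := s) hN))
  · exact fun a b hab => Set.biUnion_subset_biUnion_left fun i hi => le_trans hab hi
  · exact fun N => (MeasurableSet.iUnion fun i =>
      MeasurableSet.iUnion fun _ => hs i).nullMeasurableSet
  · exact ⟨0, measure_ne_top _ _⟩

lemma measurableSet_setOf_frequently_atTop {Z : Type*} [MeasurableSpace Z] {p : ℕ → Z → Prop}
    (hp : ∀ n, MeasurableSet {z | p n z}) : MeasurableSet {z | ∃ᶠ n in atTop, p n z} := by
  convert MeasurableSet.measurableSet_limsup hp using 1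
  ext z
  simp [mem_limsup_iff_frequently_mem]

section Birkhoff

variable {Z E : Type*} [NormedAddCommGroup E] [NormedSpace ℝ E] {T : Z → Z} {f : Z → E}

lemma birkhoffAverage_apply_eq_add (z : Z) {n : ℕ} (hn : n ≠ 0) :
    birkhoffAverage ℝ T f n (T z) = birkhoffAverage ℝ T f (n + 1) z +
      (n : ℝ)⁻¹ • (birkhoffAverage ℝ T f (n + 1) z - f z) := by
  have hn' : (n : ℝ) ≠ 0 := by exact_mod_cast hn
  have hn1 : (n : ℝ) + 1 ≠ 0 := by positivity
  simp only [birkhoffAverage, birkhoffSum_succ']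
  push_cast
  match_scalars <;> field_simp
  ring

/-- If the Birkhoff averages at `z` come infinitely often within `r` of `t`, then the ones at `T z`
come infinitely often within `r'` of `t`, for every `r' > r`. -/
lemma frequently_dist_birkhoffAverage_apply_lt {z : Z} {t : E} {r r' : ℝ} (hr : r < r')
    (h : ∃ᶠ n in atTop, dist (birkhoffAverage ℝ T f n z) t < r) :
    ∃ᶠ n in atTop, dist (birkhoffAverage ℝ T f n (T z)) t < r' := by
  rw [← map_add_atTop_eq_nat 1, frequently_map] at h
  have hlim : Tendsto (fun n : ℕ => (n : ℝ)⁻¹ * (r + dist t (f z))) atTop (𝓝 0) := by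
    simpa using tendsto_inv_atTop_nhds_zero_nat (𝕜 := ℝ) |>.mul_const (r + dist t (f z))
  refine (h.and_eventually ((hlim.eventually_lt_const (sub_pos.2 hr)).and
    (eventually_ne_atTop 0))).mono ?_
  rintro n ⟨hn, hsmall, hn0⟩
  rw [birkhoffAverage_apply_eq_add z hn0]
  set a := birkhoffAverage ℝ T f (n + 1) z
  have hfz : dist a (f z) ≤ r + dist t (f z) := by linarith [dist_triangle a t (f z)]
  have hstep : dist (a + (n : ℝ)⁻¹ • (a - f z)) a ≤ (n : ℝ)⁻¹ * (r + dist t (f z)) := by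
    rw [dist_self_add_left, norm_smul, ← dist_eq_norm, Real.norm_of_nonneg (by positivity)]
    gcongr
  linarith [dist_triangle (a + (n : ℝ)⁻¹ • (a - f z)) a t]

variable [MeasurableSpace Z] [MeasurableSpace E] [BorelSpace E] [SecondCountableTopology E]

lemma Measurable.birkhoffAverage (hf : Measurable f) (hT : Measurable T) (n : ℕ) :
    Measurable (birkhoffAverage ℝ T f n) :=
  (Finset.measurable_fun_sum _ fun k _ => hf.comp (hT.iterate k)).const_smul _

/-- If the Birkhoff averages of an ergodic transformation lie in the ball `B(t, r)` with probability
eventually bounded below, then almost surely they come infinitely often within `r'` of `t`, for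
every `r' > r`. -/
lemma ae_frequently_dist_birkhoffAverage_lt {P : Measure Z} [IsFiniteMeasure P]
    (hT : Ergodic T P) (hf : Measurable f) {t : E} {r r' : ℝ} (hr : r < r') {c : ENNReal}
    (hc0 : c ≠ 0)
    (hc : ∀ᶠ n in atTop, c ≤ P (birkhoffAverage ℝ T f n ⁻¹' Metric.ball t r)) :
    ∀ᵐ z ∂P, ∃ᶠ n in atTop, dist (birkhoffAverage ℝ T f n z) t < r' := by
  have hmeas (ρ : ℝ) (n : ℕ) : MeasurableSet {z | dist (birkhoffAverage ℝ T f n z) t < ρ} :=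
    (hf.birkhoffAverage hT.measurable n) Metric.isOpen_ball.measurableSet
  set I : Set Z :=
    {z | ∀ k : ℕ, ∃ᶠ n in atTop, dist (birkhoffAverage ℝ T f n z) t < r + 1 / ((k : ℝ) + 1)}
    with hI
  have hImeas : MeasurableSet I := by
    rw [hI, Set.ofPred_forall]
    exact MeasurableSet.iInter fun k => measurableSet_setOf_frequently_atTop (hmeas _)
  have hIT : I ⊆ T ⁻¹' I := fun z hz k =>
    frequently_dist_birkhoffAverage_apply_lt
      (add_lt_add_right (Nat.one_div_lt_one_div (Nat.lt_succ_self k)) r) (hz (k + 1))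
  have hlimsup : c ≤ P I := by
    refine (le_measure_limsup_of_eventually_le (hmeas r) hc).trans (measure_mono fun z hz k => ?_)
    rw [mem_limsup_iff_frequently_mem] at hz
    exact hz.mono fun n hn => lt_add_of_lt_of_pos hn Nat.one_div_pos_of_nat
  rcases hT.ae_empty_or_univ_of_ae_le_preimage hImeas.nullMeasurableSet
    hIT.eventuallyLE with h | h
  · exact absurd (le_antisymm (hlimsup.trans_eq (ae_eq_empty.1 h)) zero_le) hc0
  · obtain ⟨k, hk⟩ := exists_nat_one_div_lt (sub_pos.2 hr)
    filter_upwards [eventuallyEq_univ.1 h] with z hz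
    exact (hz k).mono fun n hn => by linarith

end Birkhoff

/-- A form of the portmanteau theorem for laws of random variables: an open set of positive measure
under the weak limit has probability eventually bounded below. -/
lemma exists_eventually_le_measure_preimage_of_tendsto {Z E : Type*} [MeasurableSpace Z]
    [TopologicalSpace E] [MeasurableSpace E] [BorelSpace E] [HasOuterApproxClosed E]
    {P : Measure Z} [IsProbabilityMeasure P] {m : Measure E} [IsProbabilityMeasure m]
    {X : ℕ → Z → E} (hX : ∀ n, Measurable (X n))
    (hconv : ∀ g : BoundedContinuousFunction E ℝ,
      Tendsto (fun n => ∫ z, g (X n z) ∂P) atTop (𝓝 (∫ v, g v ∂m)))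
    {U : Set E} (hU : IsOpen U) (hmU : 0 < m U) :
    ∃ c : ENNReal, c ≠ 0 ∧ ∀ᶠ n in atTop, c ≤ P (X n ⁻¹' U) := by
  let μ : ProbabilityMeasure E := ⟨m, inferInstance⟩
  let ν : ℕ → ProbabilityMeasure E := fun n =>
    ⟨P.map (X n), Measure.isProbabilityMeasure_map (hX n).aemeasurable⟩
  have hlim : Tendsto ν atTop (𝓝 μ) := by
    rw [ProbabilityMeasure.tendsto_iff_forall_integral_tendsto]
    intro g
    refine (hconv g).congr fun n => ?_
    exact (integral_map (hX n).aemeasurable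
      g.continuous.measurable.aestronglyMeasurable).symm
  obtain ⟨c, hc0, hc⟩ := exists_between
    (hmU.trans_le (ProbabilityMeasure.le_liminf_measure_open_of_tendsto hlim hU))
  refine ⟨c, hc0.ne', (eventually_lt_of_lt_liminf hc).mono fun n hn => ?_⟩
  rw [← Measure.map_apply (hX n) hU.measurableSet]
  exact hn.le

/-- If `T` is a measure-preserving ergodic transformation of a probability
space `(Z, ℙ)`, `f : Z → ℝ^d` is measurable, `Sₙ = Σ_{k<n} f ∘ Tᵏ`, and the laws of
`Sₙ/n` converge weakly to a probability measure `m` on `ℝ^d`, then almost surely every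
point of the topological support of `m` (i.e. every `t` all of whose metric balls have
positive `m`-measure) is an accumulation point of the sequence `(Sₙ(z)/n)ₙ`. -/
theorem accumulation_points_contain_support_of_weak_limit
    {Z : Type*} [MeasurableSpace Z] (P : Measure Z) [IsProbabilityMeasure P]
    (T : Z → Z) (hT : Ergodic T P)
    {d : ℕ} (f : Z → EuclideanSpace ℝ (Fin d)) (hf : Measurable f)
    (m : Measure (EuclideanSpace ℝ (Fin d))) [IsProbabilityMeasure m]
    (hconv : ∀ g : BoundedContinuousFunction (EuclideanSpace ℝ (Fin d)) ℝ,
      Tendsto (fun n : ℕ =>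
          ∫ z, g ((n : ℝ)⁻¹ • ∑ k ∈ Finset.range n, f (T^[k] z)) ∂P)
        atTop (𝓝 (∫ v, g v ∂m))) :
    ∀ᵐ z ∂P, ∀ t : EuclideanSpace ℝ (Fin d),
      (∀ ε > (0 : ℝ), 0 < m (Metric.ball t ε)) →
      MapClusterPt t atTop
        (fun n : ℕ => (n : ℝ)⁻¹ • ∑ k ∈ Finset.range n, f (T^[k] z)) := by
  have hX (n : ℕ) : Measurable (birkhoffAverage ℝ T f n) := hf.birkhoffAverage hT.measurable n
  obtain ⟨D, hDc, hD⟩ := TopologicalSpace.exists_countable_dense (EuclideanSpace ℝ (Fin d))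
  have hae : ∀ᵐ z ∂P, ∀ q ∈ D, ∀ k : ℕ, 0 < m (Metric.ball q (1 / ((k : ℝ) + 1))) →
      ∃ᶠ n in atTop, dist (birkhoffAverage ℝ T f n z) q < 2 * (1 / ((k : ℝ) + 1)) := by
    refine (ae_ball_iff hDc).2 fun q _ => ae_all_iff.2 fun k => ?_
    by_cases hpos : 0 < m (Metric.ball q (1 / ((k : ℝ) + 1)))
    · obtain ⟨c, hc0, hc⟩ :=
        exists_eventually_le_measure_preimage_of_tendsto hX hconv Metric.isOpen_ball hpos
      have hk : 1 / ((k : ℝ) + 1) < 2 * (1 / ((k : ℝ) + 1)) :=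
        lt_two_mul_self Nat.one_div_pos_of_nat
      exact (ae_frequently_dist_birkhoffAverage_lt hT hf hk hc0 hc).mono fun z hz _ => hz
    · exact Eventually.of_forall fun z h => absurd h hpos
  filter_upwards [hae] with z hz t ht
  refine Metric.nhds_basis_ball.mapClusterPt_iff_frequently.2 fun ε hε => ?_
  obtain ⟨k, hk⟩ := exists_nat_one_div_lt (show 0 < ε / 3 by positivity)
  have hk0 : 0 < 1 / ((k : ℝ) + 1) := Nat.one_div_pos_of_nat
  obtain ⟨q, hqD, hq⟩ := hD.exists_dist_lt t (half_pos hk0)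
  have hball : Metric.ball t (1 / ((k : ℝ) + 1) / 2) ⊆ Metric.ball q (1 / ((k : ℝ) + 1)) :=
    Metric.ball_subset_ball' (by linarith)
  refine (hz q hqD k ((ht _ (half_pos hk0)).trans_le (measure_mono hball))).mono fun n hn => ?_
  change dist (birkhoffAverage ℝ T f n z) t < ε
  linarith [dist_triangle_right (birkhoffAverage ℝ T f n z) t q]
end
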